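/- Let d : ℕ and let h : (Fin d → ℝ) → (Fin d → ℝ) be a homeomorphism (a continuous bijection with continuous inverse). Let S, T, S', T' ⊆ Fin d and assume (S, T) and (S', T') are admissible block pairs for h. Then the cardinality of S ∩ S' equals the cardinality of T ∩ T', and the cardinality of S ∪ S' equals the cardinality of T ∪ T'. -/

import Mathlib

/-- `F` depends only on the coordinates in `A`. -/
def DependsOnlyOn {d : ℕ} {Y : Type*} (F : (Fin d → ℝ) → Y) (A : Set (Fin d)) : Prop :=
  ∀ z z' : Fin d → ℝ, (∀ j ∈ A, z j = z' j) → F z = F z'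

/-- `(S, T)` is an admissible block pair for `h`: every component of `h` with index in `T`
depends only on `S`, and every component with index in `Tᶜ` depends only on `Sᶜ`. -/
def AdmissibleBlockPair {d : ℕ} (h : (Fin d → ℝ) → (Fin d → ℝ))
    (S T : Set (Fin d)) : Prop :=
  (∀ i ∈ T, DependsOnlyOn (fun z => h z i) S) ∧
  (∀ i ∈ Tᶜ, DependsOnlyOn (fun z => h z i) Sᶜ)

open Set Metric MeasureTheory Topology Filter in
theorem ibd_smooth_approx {E F : Type*} [NormedAddCommGroup E] [NormedSpace ℝ E]
    [FiniteDimensional ℝ E] [NormedAddCommGroup F] [NormedSpace ℝ F]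
    (f : E → F) (hf : Continuous f) (ε : E → ℝ) (hε : Continuous ε) (hpos : ∀ x, 0 < ε x) :
    ∃ g : E → F, ContDiff ℝ 1 g ∧ ∀ x, dist (g x) (f x) < ε x := by
  obtain ⟨g, hg⟩ := exists_contMDiffMap_forall_mem_convex_of_local_const (n := 1)
    (modelWithCornersSelf ℝ E) (M := E) (F := F) (t := fun x => ball (f x) (ε x))
    (fun x => convex_ball _ _) (fun x => ⟨f x, by
      have h : Continuous fun y => dist (f x) (f y) - ε y := by fun_prop
      have := h.continuousAt (x := x)
      have h2 : ∀ᶠ y in 𝓝 x, dist (f x) (f y) - ε y < 0 :=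
        this.eventually_lt_const (by simpa using hpos x)
      filter_upwards [h2] with y hy
      rw [mem_ball]; linarith⟩)
  exact ⟨g, g.contMDiff.contDiff, fun x => mem_ball.1 (hg x)⟩

theorem ibd_poly {E : Type*} [NormedAddCommGroup E] [NormedSpace ℝ E]
    [FiniteDimensional ℝ E] (A : E →L[ℝ] E) :
    ∃ p : Polynomial ℝ, p.natDegree ≤ Module.finrank ℝ E ∧
      ∀ t : ℝ, p.eval t = (ContinuousLinearMap.id ℝ E + t • A).det := by
  classical
  let b := Module.finBasis ℝ E
  let M := LinearMap.toMatrix b b (A : E →ₗ[ℝ] E)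
  refine ⟨Matrix.det ((Polynomial.X : Polynomial ℝ) • M.map Polynomial.C
    + (1 : Matrix _ _ ℝ).map Polynomial.C), ?_, ?_⟩
  · simpa using Polynomial.natDegree_det_X_add_C_le M 1
  · intro t
    rw [ContinuousLinearMap.det, ← LinearMap.det_toMatrix b, ← Polynomial.coe_evalRingHom,
      RingHom.map_det]
    congr 1
    ext i j
    by_cases hij : i = j <;>
    simp [M, hij, add_comm, Matrix.one_apply, LinearMap.toMatrix_apply, Finsupp.single_apply, eq_comm] <;> ring

theorem ibd_lagrange (n : ℕ) (δ : ℝ) (hδ : 0 < δ) : ∃ (v : Fin (n+1) → ℝ) (w : Fin (n+1) → ℝ),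
    (∀ i, 0 < v i ∧ v i < δ) ∧ ∑ i, w i = 1 ∧
    ∀ p : Polynomial ℝ, p.natDegree ≤ n → p.eval 1 = ∑ i, w i * p.eval (v i) := by
  classical
  let v : Fin (n+1) → ℝ := fun i => δ * ((i : ℝ) + 1) / (n + 2)
  have hn : (0:ℝ) < n + 2 := by positivity
  have hinj : Set.InjOn v (Finset.univ : Finset (Fin (n+1))) := by
    intro i _ j _ h
    simp only [v] at h
    field_simp at h
    have : (i : ℝ) = j := by linarith
    exact Fin.ext (by exact_mod_cast this)
  have key : ∀ p : Polynomial ℝ, p.natDegree ≤ n →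
      p.eval 1 = ∑ i, (Lagrange.basis Finset.univ v i).eval 1 * p.eval (v i) := by
    intro p hp
    have := Lagrange.eq_interpolate (s := Finset.univ) hinj (f := p) (by
      rw [Finset.card_univ, Fintype.card_fin]
      exact lt_of_le_of_lt Polynomial.degree_le_natDegree (by exact_mod_cast Nat.lt_succ_of_le hp))
    conv_lhs => rw [this]
    simp [Lagrange.interpolate_apply, Polynomial.eval_finsetSum, mul_comm]
  refine ⟨v, fun i => (Lagrange.basis Finset.univ v i).eval 1, ?_, ?_, key⟩
  · intro i
    refine ⟨by simp only [v]; positivity, ?_⟩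
    simp only [v]
    rw [div_lt_iff₀ hn]
    have : (i : ℝ) < n + 1 := by exact_mod_cast i.2
    nlinarith
  · have := key 1 (by simp)
    simpa using this.symm

open Set Metric in
theorem ibd_lip {E : Type*} [NormedAddCommGroup E] [NormedSpace ℝ E]
    (g : E → E) (r L : ℝ) (hL : 0 ≤ L)
    (hlip : ∀ x ∈ closedBall (0 : E) r, ∀ y ∈ closedBall (0 : E) r, ‖g x - g y‖ ≤ L * ‖x - y‖)
    (hb : ∀ x, ‖x‖ = r → g x = 0) (u : E → E)
    (hu1 : ∀ x, ‖x‖ ≤ r → u x = g x) (hu2 : ∀ x, r < ‖x‖ → u x = 0) (x y : E) :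
    ‖u x - u y‖ ≤ L * ‖x - y‖ := by
  have mix : ∀ x y : E, ‖x‖ ≤ r → r < ‖y‖ → ‖u x‖ ≤ L * ‖x - y‖ := by
    intro x y hx hy
    have hc : ContinuousOn (fun s : ℝ => ‖x + s • (y - x)‖) (Icc 0 1) := by fun_prop
    obtain ⟨s, hs, hs'⟩ := intermediate_value_Icc zero_le_one hc
      (show r ∈ Icc _ _ by constructor <;> simp [hx, hy.le])
    simp only at hs'
    have h1 := hlip x (by simpa using hx) (x + s • (y - x)) (by simp [hs'])
    rw [hb _ hs', sub_zero] at h1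
    rw [hu1 x hx]
    refine h1.trans (mul_le_mul_of_nonneg_left ?_ hL)
    have : x - (x + s • (y - x)) = s • (x - y) := by
      rw [← neg_sub y x, smul_neg]; abel
    rw [this, norm_smul, Real.norm_of_nonneg hs.1]
    exact mul_le_of_le_one_left (norm_nonneg _) hs.2
  rcases le_or_gt ‖x‖ r with hx | hx <;> rcases le_or_gt ‖y‖ r with hy | hy
  · rw [hu1 x hx, hu1 y hy]; exact hlip x (by simpa using hx) y (by simpa using hy)
  · rw [hu2 y hy, sub_zero]; exact mix x y hx hy
  · rw [hu2 x hx, zero_sub, norm_neg, norm_sub_rev x y]; exact mix y x hy hx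
  · rw [hu2 x hx, hu2 y hy]; simp; positivity

theorem ibd_bij {E : Type*} [NormedAddCommGroup E] [NormedSpace ℝ E] [CompleteSpace E]
    (u : E → E) (c : ℝ) (hc0 : 0 ≤ c) (hc : c < 1) (hu : ∀ x y, ‖u x - u y‖ ≤ c * ‖x - y‖) :
    Function.Bijective (fun x => x + u x) := by
  constructor
  · intro x y h
    simp only at h
    have h1 : x - y = u y - u x := by rw [sub_eq_sub_iff_add_eq_add, h, add_comm]
    have h2 := hu y x
    rw [← h1, norm_sub_rev y x] at h2
    have : ‖x - y‖ = 0 := by nlinarith [norm_nonneg (x - y)]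
    exact sub_eq_zero.1 (norm_eq_zero.1 this)
  · intro y
    have : ContractingWith ⟨c, hc0⟩ (fun x => y - u x) := by
      refine ⟨by exact_mod_cast hc, LipschitzWith.of_dist_le_mul fun a b => ?_⟩
      rw [dist_eq_norm, dist_eq_norm, sub_sub_sub_cancel_left, norm_sub_rev a b]
      exact hu b a
    refine ⟨this.fixedPoint, ?_⟩
    have h := this.fixedPoint_isFixedPt
    unfold Function.IsFixedPt at h
    simp only at h ⊢
    nth_rewrite 1 [← h]
    simp

open Set Metric MeasureTheory Topology in
theorem ibd_no_retraction {E : Type*} [NormedAddCommGroup E] [InnerProductSpace ℝ E]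
    [FiniteDimensional ℝ E] [MeasurableSpace E] [BorelSpace E] (f : E → E)
    (hf : ContDiff ℝ 1 f) (r : ℝ) (hr : 0 < r) (hn : ∀ x, ‖f x‖ = r)
    (hb : ∀ x, ‖x‖ = r → f x = x) : False := by
  let g : E → E := fun x => f x - x
  have hg : ContDiff ℝ 1 g := hf.sub contDiff_id
  have hgd : Differentiable ℝ g := hg.differentiable (by norm_num)
  have hfd : Differentiable ℝ f := hf.differentiable (by norm_num)
  have hg'c : Continuous (fderiv ℝ g) := hg.continuous_fderiv (by norm_num)
  let K : Set E := closedBall 0 r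
  have hK : IsCompact K := isCompact_closedBall _ _
  obtain ⟨L, hL⟩ := hK.exists_bound_of_continuousOn hg'c.continuousOn
  have hL0 : 0 ≤ L := (norm_nonneg _).trans (hL 0 (by simp [K, hr.le]))
  have hlip : ∀ x ∈ K, ∀ y ∈ K, ‖g x - g y‖ ≤ L * ‖x - y‖ := by
    intro x hx y hy
    exact (convex_closedBall (0:E) r).norm_image_sub_le_of_norm_fderiv_le
      (fun z _ => hgd z) hL hy hx
  have hgb : ∀ x, ‖x‖ = r → g x = 0 := fun x hx => by simp [g, hb x hx]
  classical
  let u : E → E := fun x => if ‖x‖ ≤ r then g x else 0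
  have hu1 : ∀ x, ‖x‖ ≤ r → u x = g x := fun x hx => by simp [u, hx]
  have hu2 : ∀ x, r < ‖x‖ → u x = 0 := fun x hx => by simp [u, not_le.2 hx]
  have hulip := ibd_lip g r L hL0 hlip hgb u hu1 hu2
  -- positivity of the determinant
  obtain ⟨δ, hδ, hdet⟩ : ∃ δ > 0, ∀ B : E →L[ℝ] E, ‖B‖ < δ →
      0 < (ContinuousLinearMap.id ℝ E + B).det := by
    have hc : Continuous fun B : E →L[ℝ] E => (ContinuousLinearMap.id ℝ E + B).det :=
      ContinuousLinearMap.continuous_det.comp (continuous_const.add continuous_id)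
    have h1 : ∀ᶠ B in 𝓝 (0 : E →L[ℝ] E), 0 < (ContinuousLinearMap.id ℝ E + B).det :=
      hc.continuousAt.eventually_const_lt (by simp [ContinuousLinearMap.det])
    obtain ⟨δ, hδ, h⟩ := Metric.eventually_nhds_iff.1 h1
    exact ⟨δ, hδ, fun B hB => h (by simpa using hB)⟩
  obtain ⟨v, w, hv, hw, hlag⟩ := ibd_lagrange (Module.finrank ℝ E)
    (min δ 1 / (L + 1)) (by positivity)
  let D : ℝ → E → ℝ := fun t x => (ContinuousLinearMap.id ℝ E + t • fderiv ℝ g x).det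
  have hDc : ∀ t, Continuous (D t) := fun t =>
    ContinuousLinearMap.continuous_det.comp (continuous_const.add (hg'c.const_smul t))
  have hDi : ∀ t, IntegrableOn (D t) K := fun t => (hDc t).continuousOn.integrableOn_compact hK
  have hD1 : ∀ x, D 1 x = 0 := by
    intro x
    have hfx : ContinuousLinearMap.id ℝ E + (1:ℝ) • fderiv ℝ g x = fderiv ℝ f x := by
      have : fderiv ℝ g x = fderiv ℝ f x - ContinuousLinearMap.id ℝ E := by
        simp only [g]
        rw [fderiv_fun_sub (hfd x) differentiableAt_fun_id, fderiv_id']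
      rw [this]; simp
    simp only [D]
    rw [hfx]
    by_contra hne
    have hsurj : Function.Surjective (fderiv ℝ f x) := by
      have := LinearMap.equivOfDetNeZero (fderiv ℝ f x : E →ₗ[ℝ] E) hne
      exact (LinearEquiv.surjective (LinearMap.equivOfDetNeZero (fderiv ℝ f x : E →ₗ[ℝ] E) hne))
    obtain ⟨z, hz⟩ := hsurj (f x)
    have h1 : HasFDerivAt (fun y => inner ℝ (f y) (f y)) _ x :=
      (hfd x).hasFDerivAt.inner ℝ (hfd x).hasFDerivAt
    have h2 : (fun y => inner ℝ (f y) (f y)) = fun _ => r ^ 2 := by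
      ext y; rw [real_inner_self_eq_norm_sq, hn]
    rw [h2] at h1
    have h3 := congrArg (fun A : E →L[ℝ] ℝ => A z) (h1.unique (hasFDerivAt_const _ _))
    simp [hz, hn] at h3
    exact hr.ne' h3
  have hDv : ∀ i, ∫ x in K, D (v i) x = (volume K).toReal := by
    intro i
    obtain ⟨hv0, hvd⟩ := hv i
    rw [lt_div_iff₀ (by positivity), lt_min_iff] at hvd
    have hvL : v i * L < δ ∧ v i * L < 1 := ⟨by nlinarith, by nlinarith⟩
    have hbij := ibd_bij (fun x => v i • u x) (v i * L) (by positivity) hvL.2 (by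
      intro x y
      rw [← smul_sub, norm_smul, Real.norm_of_nonneg hv0.le, mul_assoc]
      exact mul_le_mul_of_nonneg_left (hulip x y) hv0.le)
    have himg : (fun x => x + v i • g x) '' K = K := by
      have h1 : (fun x => x + v i • g x) '' K = (fun x => x + v i • u x) '' K := by
        apply image_congr
        intro x hx
        rw [hu1 x (by simpa [K] using hx)]
      have h2 : (fun x => x + v i • u x) '' Kᶜ = Kᶜ := by
        have : EqOn (fun x => x + v i • u x) id Kᶜ := by
          intro x hx
          simp only [K, mem_compl_iff, mem_closedBall, dist_zero_right, not_le] at hx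
          simp [hu2 x hx]
        rw [this.image_eq, image_id]
      rw [h1, ← compl_inj_iff, ← image_compl_eq hbij, h2]
    have hinj : InjOn (fun x => x + v i • g x) K := by
      intro x hx y hy hxy
      apply hbij.1
      simp only
      rw [hu1 x (by simpa [K] using hx), hu1 y (by simpa [K] using hy)]
      exact hxy
    have h3 := integral_image_eq_integral_abs_det_fderiv_smul volume
      (s := K) (f := fun x => x + v i • g x)
      (f' := fun x => ContinuousLinearMap.id ℝ E + v i • fderiv ℝ g x)
      isClosed_closedBall.measurableSet
      (fun x _ => ((hasFDerivAt_id x).add ((hgd x).hasFDerivAt.const_smul (v i))).hasFDerivWithinAt)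
      hinj (fun _ => (1:ℝ))
    rw [himg] at h3
    have h4 : ∫ x in K, D (v i) x =
        ∫ x in K, |(ContinuousLinearMap.id ℝ E + v i • fderiv ℝ g x).det| • (1:ℝ) := by
      apply setIntegral_congr_fun isClosed_closedBall.measurableSet
      intro x hx
      have hpos : 0 < (ContinuousLinearMap.id ℝ E + v i • fderiv ℝ g x).det := by
        apply hdet
        rw [norm_smul, Real.norm_of_nonneg hv0.le]
        exact lt_of_le_of_lt (mul_le_mul_of_nonneg_left (hL x hx) hv0.le) hvL.1
      simp [D, abs_of_pos hpos]
    rw [h4, ← h3]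
    simp [Measure.real]
  have hpt : ∀ x, ∑ i, w i * D (v i) x = 0 := by
    intro x
    obtain ⟨p, hp, hpe⟩ := ibd_poly (fderiv ℝ g x)
    have := hlag p hp
    simp only [hpe] at this
    rw [← hD1 x]
    exact this.symm
  have hsum : ∫ x in K, ∑ i, w i * D (v i) x = ∑ i, w i * (volume K).toReal := by
    rw [integral_finsetSum _ (fun i _ => (hDi (v i)).const_mul (w i))]
    refine Finset.sum_congr rfl fun i _ => ?_
    rw [integral_const_mul, hDv]
  simp only [hpt, integral_zero] at hsum
  rw [← Finset.sum_mul, hw, one_mul] at hsum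
  have hvol : 0 < (volume K).toReal :=
    ENNReal.toReal_pos (measure_closedBall_pos volume _ hr).ne' hK.measure_lt_top.ne
  exact hvol.ne hsum

open Set Metric in
theorem ibd_dim {m n : ℕ} (φ : EuclideanSpace ℝ (Fin m) → EuclideanSpace ℝ (Fin n))
    (ψ : EuclideanSpace ℝ (Fin n) → EuclideanSpace ℝ (Fin m))
    (hφ : Continuous φ) (hψ : Continuous ψ) (hφψ : ∀ y, φ (ψ y) = y) : n ≤ m := by
  by_contra hlt
  push Not at hlt
  obtain ⟨p, hp, hpd⟩ := ibd_smooth_approx φ hφ (fun _ => 1/3) continuous_const (by norm_num)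
  obtain ⟨c, hc, hcd⟩ := (hp.dense_compl_range_of_finrank_lt_finrank
    (by simpa using hlt)).exists_dist_lt 0 (show (0:ℝ) < 1/3 by norm_num)
  rw [dist_zero_left] at hcd
  let q := fun y => p (ψ y) - c
  have hq : Continuous q := (hp.continuous.comp hψ).sub continuous_const
  have hq0 : ∀ y, q y ≠ 0 := fun y h => hc ⟨ψ y, sub_eq_zero.1 h⟩
  have hqd : ∀ y, ‖q y - y‖ < 2/3 := by
    intro y
    have h1 := hpd (ψ y)
    rw [hφψ, dist_eq_norm] at h1
    have : q y - y = (p (ψ y) - y) - c := by simp only [q]; abel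
    rw [this]
    linarith [norm_sub_le (p (ψ y) - y) c]
  obtain ⟨s, hs, hsd⟩ := ibd_smooth_approx q hq (fun y => min (1/3) ‖q y‖)
    (by fun_prop) (fun y => lt_min (by norm_num) (norm_pos_iff.2 (hq0 y)))
  have hs0 : ∀ y, s y ≠ 0 := by
    intro y h
    have := (lt_min_iff.1 (hsd y)).2
    rw [h, dist_zero_left] at this
    exact lt_irrefl _ this
  have hs1 : ∀ y, ‖s y - y‖ < 1 := by
    intro y
    have h1 := (lt_min_iff.1 (hsd y)).1
    rw [dist_eq_norm] at h1
    have : s y - y = (s y - q y) + (q y - y) := by abel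
    rw [this]
    linarith [norm_add_le (s y - q y) (q y - y), hqd y]
  let χ : ContDiffBump (0 : EuclideanSpace ℝ (Fin n)) := ⟨1, 2, by norm_num, by norm_num⟩
  let Q := fun y => y + χ y • (s y - y)
  have hQ : ContDiff ℝ 1 Q := contDiff_id.add (χ.contDiff.smul (hs.sub contDiff_id))
  have hQ0 : ∀ y, Q y ≠ 0 := by
    intro y h
    rcases le_or_gt ‖y‖ 1 with hy | hy
    · have : χ y = 1 := χ.one_of_mem_closedBall (by simpa [χ] using hy)
      simp [Q, this] at h
      exact hs0 y h
    · have h1 : y = - (χ y • (s y - y)) := eq_neg_of_add_eq_zero_left h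
      have h2 : ‖y‖ = χ y * ‖s y - y‖ := by
        conv_lhs => rw [h1]
        rw [norm_neg, norm_smul, Real.norm_of_nonneg χ.nonneg]
      have h3 : χ y ≤ 1 := χ.le_one
      have h4 : 0 ≤ χ y := χ.nonneg
      nlinarith [hs1 y, norm_nonneg (s y - y)]
  refine ibd_no_retraction (fun y => (2 * ‖Q y‖⁻¹) • Q y) ?_ 2 (by norm_num) ?_ ?_
  · exact (contDiff_const.mul ((hQ.norm ℝ hQ0).inv (fun y => norm_ne_zero_iff.2 (hQ0 y)))).smul hQ
  · intro y
    have := norm_ne_zero_iff.2 (hQ0 y)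
    rw [norm_smul, norm_mul, norm_inv, norm_norm]
    field_simp
    simp
  · intro y hy
    have : χ y = 0 := χ.zero_of_le_dist (by simp [χ, hy])
    simp [Q, this, hy]

theorem ibd_card_le {d : ℕ} (h : (Fin d → ℝ) ≃ₜ (Fin d → ℝ)) (S T : Set (Fin d))
    (h1 : AdmissibleBlockPair (fun z => h z) S T) : T.ncard ≤ S.ncard := by
  classical
  let e1 : EuclideanSpace ℝ (Fin (Fintype.card S)) ≃ₜ (S → ℝ) :=
    (EuclideanSpace.equiv _ ℝ).toHomeomorph.trans
      (Homeomorph.piCongrLeft (Y := fun _ => ℝ) (Fintype.equivFin S).symm)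
  let e2 : EuclideanSpace ℝ (Fin (Fintype.card T)) ≃ₜ (T → ℝ) :=
    (EuclideanSpace.equiv _ ℝ).toHomeomorph.trans
      (Homeomorph.piCongrLeft (Y := fun _ => ℝ) (Fintype.equivFin T).symm)
  let F : (S → ℝ) → (T → ℝ) := fun x i => h (fun j => if hj : j ∈ S then x ⟨j, hj⟩ else 0) i
  let G : (T → ℝ) → (S → ℝ) := fun y j =>
    h.symm (fun i => if hi : i ∈ T then y ⟨i, hi⟩ else 0) j
  have hF : Continuous F := by
    refine continuous_pi fun i => (continuous_apply _).comp (h.continuous.comp ?_)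
    refine continuous_pi fun j => ?_
    by_cases hj : j ∈ S <;> simp only [hj, dite_true, dite_false] <;> fun_prop
  have hG : Continuous G := by
    refine continuous_pi fun i => (continuous_apply _).comp (h.symm.continuous.comp ?_)
    refine continuous_pi fun j => ?_
    by_cases hj : j ∈ T <;> simp only [hj, dite_true, dite_false] <;> fun_prop
  have hFG : ∀ y, F (G y) = y := by
    intro y
    ext i
    have := h1.1 i i.2 (fun j => if hj : j ∈ S then G y ⟨j, hj⟩ else 0)
      (h.symm (fun i => if hi : i ∈ T then y ⟨i, hi⟩ else 0))
      (fun j hj => by simp [hj, G])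
    simp only [F]
    simp only at this
    rw [this]
    simp
  have := ibd_dim (fun x => e2.symm (F (e1 x))) (fun y => e1.symm (G (e2 y)))
    (e2.symm.continuous.comp (hF.comp e1.continuous))
    (e1.symm.continuous.comp (hG.comp e2.continuous)) (fun y => by simp [hFG])
  rwa [← Nat.card_eq_fintype_card, ← Nat.card_eq_fintype_card, Nat.card_coe_set_eq,
    Nat.card_coe_set_eq] at this

theorem ibd_card_eq {d : ℕ} (h : (Fin d → ℝ) ≃ₜ (Fin d → ℝ)) (S T : Set (Fin d))
    (h1 : AdmissibleBlockPair (fun z => h z) S T) : S.ncard = T.ncard := by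
  have a := ibd_card_le h S T h1
  have b := ibd_card_le h Sᶜ Tᶜ ⟨h1.2, by simpa using h1.1⟩
  have c := Set.ncard_add_ncard_compl S
  have c' := Set.ncard_add_ncard_compl T
  omega

theorem DependsOnlyOn.ibd_mono {d : ℕ} {Y : Type*} {F : (Fin d → ℝ) → Y} {A B : Set (Fin d)}
    (h : DependsOnlyOn F A) (hAB : A ⊆ B) : DependsOnlyOn F B :=
  fun z z' hz => h z z' fun j hj => hz j (hAB hj)

theorem DependsOnlyOn.ibd_inter {d : ℕ} {Y : Type*} {F : (Fin d → ℝ) → Y} {A B : Set (Fin d)}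
    (hA : DependsOnlyOn F A) (hB : DependsOnlyOn F B) : DependsOnlyOn F (A ∩ B) := by
  classical
  intro z z' hz
  refine (hA z (fun j => if j ∈ A then z j else z' j) (fun j hj => by simp [hj])).trans
    (hB _ _ fun j hj => ?_)
  by_cases hjA : j ∈ A
  · simp [hjA, hz j ⟨hjA, hj⟩]
  · simp [hjA]

theorem AdmissibleBlockPair.ibd_inter {d : ℕ} {h : (Fin d → ℝ) → (Fin d → ℝ)}
    {S T S' T' : Set (Fin d)} (h1 : AdmissibleBlockPair h S T)
    (h2 : AdmissibleBlockPair h S' T') : AdmissibleBlockPair h (S ∩ S') (T ∩ T') := by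
  refine ⟨fun i hi => (h1.1 i hi.1).ibd_inter (h2.1 i hi.2), fun i hi => ?_⟩
  rw [Set.compl_inter] at hi ⊢
  rcases hi with hi | hi
  · exact (h1.2 i hi).ibd_mono Set.subset_union_left
  · exact (h2.2 i hi).ibd_mono Set.subset_union_right

theorem AdmissibleBlockPair.ibd_union {d : ℕ} {h : (Fin d → ℝ) → (Fin d → ℝ)}
    {S T S' T' : Set (Fin d)} (h1 : AdmissibleBlockPair h S T)
    (h2 : AdmissibleBlockPair h S' T') : AdmissibleBlockPair h (S ∪ S') (T ∪ T') := by
  refine ⟨fun i hi => ?_, fun i hi => ?_⟩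
  · rcases hi with hi | hi
    · exact (h1.1 i hi).ibd_mono Set.subset_union_left
    · exact (h2.1 i hi).ibd_mono Set.subset_union_right
  · rw [Set.compl_union] at hi ⊢
    exact (h1.2 i hi.1).ibd_inter (h2.2 i hi.2)

/-- For a homeomorphism `h` with admissible block pairs `(S, T)` and `(S', T')`, the
intersections and unions of the supports and the feature blocks have equal cardinalities. -/
theorem admissible_block_pairs_inter_union_card
    (d : ℕ) (h : (Fin d → ℝ) ≃ₜ (Fin d → ℝ)) (S T S' T' : Set (Fin d))
    (h1 : AdmissibleBlockPair (fun z => h z) S T)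
    (h2 : AdmissibleBlockPair (fun z => h z) S' T') :
    (S ∩ S').ncard = (T ∩ T').ncard ∧ (S ∪ S').ncard = (T ∪ T').ncard := by
  exact ⟨ibd_card_eq h _ _ (h1.ibd_inter h2), ibd_card_eq h _ _ (h1.ibd_union h2)⟩
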